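/- For every probability vector p and every ε > 0 there exist an integer L = L(p,ε) ≥ 10, a real δ = δ(p,ε) > 0, and a constant A such that: for all N and all integers K ≥ (C̃_p + ε)·log N, a p-random sequence S = (s_1,…,s_N) of strings of length K is regular and its shuffle graph G(S) is L-sparse with probability at least 1 − A·N^{−δ}. -/

import Mathlib

open Finset

namespace RiffleShuffle

/-- `phi p t = ∑ i, p i ^ t`. -/
noncomputable def phi {k : ℕ} (p : Fin k → ℝ) (t : ℝ) : ℝ := ∑ i, p i ^ t

/-- `psi p t = - log (phi p t)`. -/
noncomputable def psi {k : ℕ} (p : Fin k → ℝ) (t : ℝ) : ℝ := - Real.log (phi p t)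

/-- The maximal entry of `p`. -/
noncomputable def pmax {k : ℕ} (p : Fin k → ℝ) : ℝ := ⨆ i, p i

/-- The minimal entry of `p`. -/
noncomputable def pmin {k : ℕ} (p : Fin k → ℝ) : ℝ := ⨅ i, p i

/-- `C_p = (3+θ)/(4 ψ_p(2))`, where `θ` is the solution of `φ_p(θ) = φ_p(2)²`. -/
noncomputable def Cmain {k : ℕ} (p : Fin k → ℝ) (θ : ℝ) : ℝ := (3 + θ) / (4 * psi p 2)

/-- `C̃_p = 1/log(1/p_max)`. -/
noncomputable def Ctilde {k : ℕ} (p : Fin k → ℝ) : ℝ := 1 / Real.log (1 / pmax p)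

/-- `C̄_p = max(C̃_p, C_p)`. -/
noncomputable def Cbar {k : ℕ} (p : Fin k → ℝ) (θ : ℝ) : ℝ := max (Ctilde p) (Cmain p θ)

/-- Strings of length `K` over the alphabet `{0,…,k-1}`. -/
abbrev Str (k K : ℕ) := Fin K → Fin k

/-- Probability of an individual string, all digits i.i.d. with law `p`. -/
noncomputable def strP {k : ℕ} (p : Fin k → ℝ) {K : ℕ} (s : Str k K) : ℝ := ∏ j, p (s j)

/-- Probability of a tuple of `N` i.i.d. `p`-random strings. -/
noncomputable def seqP {k : ℕ} (p : Fin k → ℝ) {N K : ℕ} (ω : Fin N → Str k K) : ℝ :=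
  ∏ i, strP p (ω i)

/-- The base-`k` value of a string; comparing these values is exactly the lexicographic
order on strings of the same length. -/
def lexVal {k K : ℕ} (s : Str k K) : ℕ := ∑ j : Fin K, (s j : ℕ) * k ^ (K - 1 - (j : ℕ))

/-- The lexicographically sorted rearrangement of a tuple of strings. -/
noncomputable def sortedSeq {k N K : ℕ} (ω : Fin N → Str k K) : Fin N → Str k K :=
  fun i => ω (Tuple.sort (fun j => lexVal (ω j)) i)

/-- The edge set of the shuffle graph of a (sorted) sequence of strings: the edge between
`i` and `i+1` is present iff `s i = s (i+1)`; edges are recorded as pairs `(i, i+1)`. -/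
def edgeSet {k N K : ℕ} (s : Fin N → Str k K) : Finset (Fin N × Fin N) :=
  univ.filter (fun e => (e.2 : ℕ) = (e.1 : ℕ) + 1 ∧ s e.1 = s e.2)

/-- `s` begins with two digits equal to `d`. -/
def beginsWith2 {k : ℕ} (d : Fin k) {K : ℕ} (s : Str k K) : Prop :=
  ∃ h : 2 ≤ K, s ⟨0, by omega⟩ = d ∧ s ⟨1, by omega⟩ = d

instance {k K : ℕ} (d : Fin k) (s : Str k K) : Decidable (beginsWith2 d s) :=
  exists_prop_decidable _

/-- A sequence of strings is regular if at most `(p₀² + p₀ p_{k-1}/2) N` of its strings begin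
with two `0`-digits and at most `(p_{k-1}² + p₀ p_{k-1}/2) N` begin with two `(k-1)`-digits.
Here `d0` and `dlast` denote the digits `0` and `k-1`. -/
def Regular {k : ℕ} (p : Fin k → ℝ) (d0 dlast : Fin k) {N K : ℕ} (s : Fin N → Str k K) : Prop :=
  ((univ.filter (fun i => beginsWith2 d0 (s i))).card : ℝ)
      ≤ (p d0 ^ 2 + p d0 * p dlast / 2) * N ∧
    ((univ.filter (fun i => beginsWith2 dlast (s i))).card : ℝ)
      ≤ (p dlast ^ 2 + p d0 * p dlast / 2) * N

/-- A shuffle graph with edge set `D` is `L`-sparse if every window of `L` consecutive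
vertices `{i, …, i+L-1}` contains at most `L/3` of its edges. -/
def LSparse {N : ℕ} (L : ℕ) (D : Finset (Fin N × Fin N)) : Prop :=
  ∀ i : ℕ, ((D.filter (fun e => i ≤ (e.1 : ℕ) ∧ (e.2 : ℕ) ≤ i + L - 1)).card : ℝ) ≤ (L : ℝ) / 3

open scoped Classical in
/-- The probability that `N` independent samples with law `w` satisfy `E`. -/
noncomputable def iidProb {α : Type*} [Fintype α] (w : α → ℝ) {N : ℕ}
    (E : (Fin N → α) → Prop) : ℝ :=
  ∑ ω with E ω, ∏ i, w (ω i)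

section IidProb

variable {α : Type*} [Fintype α] {w : α → ℝ} {N : ℕ}

lemma iidProb_mono (hw : ∀ s, 0 ≤ w s) {E F : (Fin N → α) → Prop} (h : ∀ ω, E ω → F ω) :
    iidProb w E ≤ iidProb w F := by
  classical
  unfold iidProb
  exact Finset.sum_le_sum_of_subset_of_nonneg (Finset.monotone_filter_right _ fun ω _ => h ω)
    fun ω _ _ => Finset.prod_nonneg fun i _ => hw _

lemma iidProb_exists_le (hw : ∀ s, 0 ≤ w s) {β : Type*} (S : Finset β)
    (E : β → (Fin N → α) → Prop) :
    iidProb w (fun ω => ∃ a ∈ S, E a ω) ≤ ∑ a ∈ S, iidProb w (E a) := by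
  classical
  unfold iidProb
  simp_rw [Finset.sum_filter]
  rw [Finset.sum_comm]
  refine Finset.sum_le_sum fun ω _ => ?_
  have h0 : 0 ≤ ∏ i, w (ω i) := Finset.prod_nonneg fun i _ => hw _
  have hnn : ∀ a ∈ S, 0 ≤ if E a ω then ∏ i, w (ω i) else 0 := fun a _ => by split_ifs <;> simp [h0]
  split_ifs with h
  · obtain ⟨a, ha, hE⟩ := h
    calc ∏ i, w (ω i) = if E a ω then ∏ i, w (ω i) else 0 := by rw [if_pos hE]
      _ ≤ _ := Finset.single_le_sum hnn ha
  · exact Finset.sum_nonneg hnn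

lemma iidProb_or_le (hw : ∀ s, 0 ≤ w s) (E F : (Fin N → α) → Prop) :
    iidProb w (fun ω => E ω ∨ F ω) ≤ iidProb w E + iidProb w F := by
  have h := iidProb_exists_le (N := N) hw Finset.univ (fun b : Bool => if b then E else F)
  simpa [or_comm] using h

lemma iidProb_le_prod (hw : ∀ s, 0 ≤ w s) {E : (Fin N → α) → Prop} (C : ℝ) (hC : 0 ≤ C)
    (g : Fin N → α → ℝ) (hg : ∀ i s, 0 ≤ g i s) (h : ∀ ω, E ω → 1 ≤ C * ∏ i, g i (ω i)) :
    iidProb w E ≤ C * ∏ i, ∑ s, w s * g i s := by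
  classical
  rw [Finset.prod_univ_sum, Fintype.piFinset_univ, Finset.mul_sum]
  unfold iidProb
  rw [Finset.sum_filter]
  refine Finset.sum_le_sum fun ω _ => ?_
  have h0 : 0 ≤ ∏ i, w (ω i) := Finset.prod_nonneg fun i _ => hw _
  have h1 : 0 ≤ ∏ i, g i (ω i) := Finset.prod_nonneg fun i _ => hg _ _
  rw [Finset.prod_mul_distrib]
  split_ifs with hE
  · nlinarith [mul_le_mul_of_nonneg_left (h ω hE) h0]
  · positivity

lemma iidProb_add_not (hsum : ∑ s, w s = 1) (E : (Fin N → α) → Prop) :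
    iidProb w E + iidProb w (fun ω => ¬ E ω) = 1 := by
  classical
  unfold iidProb
  rw [Finset.sum_filter_add_sum_filter_not]
  have := Finset.prod_univ_sum (fun _ : Fin N => (Finset.univ : Finset α)) (fun _ s => w s)
  rw [Fintype.piFinset_univ] at this
  rw [← this]
  simp [hsum]

lemma half_le_one_sub_exp_neg_one : (1 : ℝ) / 2 ≤ 1 - Real.exp (-1) := by
  have h := Real.add_one_le_exp (1 : ℝ)
  have h2 : Real.exp (-1) * Real.exp 1 = 1 := by rw [← Real.exp_add]; simp
  nlinarith [Real.exp_pos (-1)]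

/-- Chernoff upper tail bound for the number of samples in `B`. -/
lemma iidProb_card_gt_le (hw : ∀ s, 0 ≤ w s) (hsum : ∑ s, w s = 1) (P : α → Prop)
    [DecidablePred P] {Q c : ℝ} (hQ : ∑ s with P s, w s ≤ Q) (hQ1 : Q ≤ 1) (hc : 0 ≤ c)
    (hc1 : c ≤ 1) :
    iidProb w (fun ω : Fin N → α => (Q + c) * N < ((univ.filter fun i => P (ω i)).card : ℝ))
      ≤ Real.exp (-(N * (c ^ 2 / 4))) := by
  have hb := iidProb_le_prod (N := N) hw
    (E := fun ω => (Q + c) * N < ((univ.filter fun i => P (ω i)).card : ℝ))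
    (Real.exp (-(c / 2 * ((Q + c) * N)))) (Real.exp_pos _).le
    (fun _ s => if P s then Real.exp (c / 2) else 1)
    (fun _ s => by positivity)
    (fun ω hω => by
      rw [Finset.prod_ite, Finset.prod_const, Finset.prod_const_one, mul_one, ← Real.exp_nat_mul,
        ← Real.exp_add]
      apply Real.one_le_exp
      nlinarith [mul_le_mul_of_nonneg_left hω.le (by positivity : 0 ≤ c / 2)])
  refine hb.trans ?_
  have hQ0 : 0 ≤ ∑ s with P s, w s := Finset.sum_nonneg fun s _ => hw s
  have hone : ∑ s, w s * (if P s then Real.exp (c / 2) else 1)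
      = 1 + (∑ s with P s, w s) * (Real.exp (c / 2) - 1) := by
    refine Eq.trans ?_ (congrArg (· + _) hsum)
    rw [Finset.sum_mul, Finset.sum_filter, ← Finset.sum_add_distrib]
    refine Finset.sum_congr rfl fun s _ => ?_
    split_ifs <;> ring
  have hexp : Real.exp (c / 2) - 1 ≤ c / 2 + (c / 2) ^ 2 := by
    have := Real.abs_exp_sub_one_sub_id_le (x := c / 2) (by rw [abs_le]; constructor <;> linarith)
    linarith [(abs_le.mp this).2]
  have hexp0 : 0 ≤ Real.exp (c / 2) - 1 := by linarith [Real.one_le_exp (by positivity : 0 ≤ c / 2)]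
  have hle : ∑ s, w s * (if P s then Real.exp (c / 2) else 1)
      ≤ Real.exp (Q * (c / 2) + (c / 2) ^ 2) := by
    rw [hone]
    refine le_trans ?_ (Real.add_one_le_exp _)
    have h1 : (∑ s with P s, w s) * (Real.exp (c / 2) - 1) ≤ Q * (c / 2 + (c / 2) ^ 2) :=
      mul_le_mul hQ hexp hexp0 (hQ0.trans hQ)
    nlinarith [sq_nonneg (c / 2)]
  have h0 : 0 ≤ ∑ s, w s * (if P s then Real.exp (c / 2) else 1) :=
    Finset.sum_nonneg fun s _ => mul_nonneg (hw s) (by positivity)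
  rw [Finset.prod_const, Finset.card_univ, Fintype.card_fin]
  calc _ ≤ Real.exp (-(c / 2 * ((Q + c) * N))) * Real.exp (Q * (c / 2) + (c / 2) ^ 2) ^ N := by
        gcongr
    _ = Real.exp (-(N * (c ^ 2 / 4))) := by
        rw [← Real.exp_nat_mul, ← Real.exp_add]; congr 1; ring

/-- Chernoff lower tail bound, jointly with the value of one of the samples. -/
lemma iidProb_eq_and_card_lt_le [DecidableEq α] (hw : ∀ s, 0 ≤ w s) (hsum : ∑ s, w s = 1)
    (B : Finset α) {b : ℝ} (hb : b ≤ ∑ s ∈ B, w s) (c : Fin N) (x : α) (L : ℕ) :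
    iidProb w (fun ω : Fin N → α => ω c = x ∧ (univ.filter fun i => ω i ∈ B).card < L)
      ≤ w x * (Real.exp L * Real.exp (-((N - 1) * (b / 2)))) := by
  have hN : 1 ≤ N := by have := c.2; omega
  have hP := iidProb_le_prod (N := N) hw
    (E := fun ω => ω c = x ∧ (univ.filter fun i => ω i ∈ B).card < L)
    (Real.exp L) (Real.exp_pos _).le
    (fun i s => (if i = c then (if s = x then 1 else 0) else 1) *
      (if s ∈ B then Real.exp (-1) else 1))
    (fun i s => by positivity)
    (fun ω hω => by
      rw [Finset.prod_mul_distrib, Finset.prod_ite_eq', Finset.prod_ite, Finset.prod_const,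
        Finset.prod_const_one, mul_one, ← Real.exp_nat_mul]
      simp only [mem_univ, if_true, hω.1, one_mul]
      rw [← Real.exp_add]
      apply Real.one_le_exp
      have : ((univ.filter fun i => ω i ∈ B).card : ℝ) ≤ L := by exact_mod_cast hω.2.le
      linarith)
  refine hP.trans ?_
  have hone : ∑ s, w s * (if s ∈ B then Real.exp (-1) else 1)
      = 1 - (∑ s ∈ B, w s) * (1 - Real.exp (-1)) := by
    refine Eq.trans ?_ (congrArg (· - _) hsum)
    rw [← Finset.filter_univ_mem B, Finset.sum_mul, Finset.sum_filter, ← Finset.sum_sub_distrib]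
    refine Finset.sum_congr rfl fun s _ => ?_
    simp only [Finset.filter_univ_mem]
    split_ifs <;> ring
  have hB0 : 0 ≤ ∑ s ∈ B, w s := Finset.sum_nonneg fun s _ => hw s
  have hle : ∑ s, w s * (if s ∈ B then Real.exp (-1) else 1) ≤ Real.exp (-(b / 2)) := by
    rw [hone]
    refine le_trans ?_ (Real.add_one_le_exp _)
    nlinarith [mul_le_mul_of_nonneg_left half_le_one_sub_exp_neg_one hB0]
  have h0 : 0 ≤ ∑ s, w s * (if s ∈ B then Real.exp (-1) else 1) :=
    Finset.sum_nonneg fun s _ => mul_nonneg (hw s) (by positivity)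
  rw [← Finset.mul_prod_erase _ _ (Finset.mem_univ c)]
  have hfirst : ∑ s, w s * ((if c = c then (if s = x then 1 else 0) else 1) *
      (if s ∈ B then Real.exp (-1) else 1)) ≤ w x := by
    rw [Finset.sum_eq_single x (fun s _ hs => by simp [hs]) (fun h => absurd (mem_univ x) h)]
    simp only [if_true, one_mul]
    split_ifs
    · have := Real.exp_le_one_iff.mpr (by norm_num : (-1 : ℝ) ≤ 0)
      nlinarith [hw x]
    · rw [mul_one]
  have hrest : ∏ i ∈ univ.erase c, ∑ s, w s * ((if i = c then (if s = x then 1 else 0) else 1) *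
      (if s ∈ B then Real.exp (-1) else 1)) ≤ Real.exp (-((N - 1) * (b / 2))) := by
    rw [Finset.prod_congr rfl (g := fun _ => ∑ s, w s * (if s ∈ B then Real.exp (-1) else 1))
      (fun i hi => by simp only [if_neg (Finset.ne_of_mem_erase hi), one_mul])]
    rw [Finset.prod_const, Finset.card_erase_of_mem (mem_univ c), Finset.card_univ,
      Fintype.card_fin]
    refine (pow_le_pow_left₀ h0 hle _).trans_eq ?_
    rw [← Real.exp_nat_mul, Nat.cast_sub hN]
    congr 1
    push_cast
    ring
  have hrest0 : 0 ≤ ∏ i ∈ univ.erase c, ∑ s, w s *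
      ((if i = c then (if s = x then 1 else 0) else 1) *
      (if s ∈ B then Real.exp (-1) else 1)) :=
    Finset.prod_nonneg fun i _ => Finset.sum_nonneg fun s _ => mul_nonneg (hw s) (by positivity)
  calc _ ≤ Real.exp L * (w x * Real.exp (-((N - 1) * (b / 2)))) :=
        mul_le_mul_of_nonneg_left (mul_le_mul hfirst hrest hrest0 (hw x)) (Real.exp_pos _).le
    _ = _ := by ring

lemma iidProb_forall_eq_le (hw : ∀ s, 0 ≤ w s) (hsum : ∑ s, w s = 1) {β : Type*} [Fintype β]
    (ι : β → Fin N) (hι : Function.Injective ι) (y : β → α) :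
    iidProb w (fun ω : Fin N → α => ∀ b, ω (ι b) = y b) ≤ ∏ b, w (y b) := by
  classical
  have hP := iidProb_le_prod (N := N) hw (E := fun ω => ∀ b, ω (ι b) = y b) 1 zero_le_one
    (fun i s => if ∀ b, ι b = i → s = y b then 1 else 0) (fun i s => by positivity)
    (fun ω hω => by
      rw [Finset.prod_congr rfl (g := fun _ => (1 : ℝ))]
      · simp
      · intro i _
        rw [if_pos]
        rintro b rfl
        exact hω b)
  refine hP.trans_eq ?_
  rw [one_mul]
  refine (Fintype.prod_of_injective ι hι _ _ ?_ ?_).symm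
  · intro i hi
    refine Eq.trans (Finset.sum_congr rfl fun s _ => ?_) hsum
    rw [if_pos, mul_one]
    rintro b rfl
    exact absurd ⟨b, rfl⟩ hi
  · intro b
    have : ∀ s, (∀ b', ι b' = ι b → s = y b') ↔ s = y b := fun s =>
      ⟨fun h => h b rfl, fun h b' hb' => by rw [hι hb']; exact h⟩
    simp [this]

/-- The probability that prescribed disjoint pairs of samples agree, with values in a set
depending on a further sample. -/
lemma iidProb_pairs_le (hw : ∀ s, 0 ≤ w s) (hsum : ∑ s, w s = 1) {r : ℕ}
    (ι : Option (Fin r × Bool) → Fin N) (hι : Function.Injective ι) (D : α → Finset α) {M : ℝ}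
    (hD : ∀ x, ∑ s ∈ D x, w s ^ 2 ≤ M) :
    iidProb w (fun ω : Fin N → α => ∀ j, ω (ι (some (j, false))) = ω (ι (some (j, true))) ∧
      ω (ι (some (j, false))) ∈ D (ω (ι none))) ≤ M ^ r := by
  classical
  calc _ ≤ iidProb w (fun ω : Fin N → α => ∃ x ∈ univ,
          ∃ y ∈ Fintype.piFinset (fun _ : Fin r => D x), ∀ b, ω (ι b) = b.elim x (fun q => y q.1)) := by
        refine iidProb_mono hw fun ω h => ⟨ω (ι none), mem_univ _,
          fun j => ω (ι (some (j, false))), ?_, ?_⟩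
        · simpa using fun j => (h j).2
        · rintro (_ | ⟨j, _ | _⟩)
          · rfl
          · rfl
          · exact (h j).1.symm
    _ ≤ ∑ x, ∑ y ∈ Fintype.piFinset (fun _ : Fin r => D x), w x * ∏ j, w (y j) ^ 2 := by
        refine (iidProb_exists_le hw _ _).trans (Finset.sum_le_sum fun x _ => ?_)
        refine (iidProb_exists_le hw _ _).trans (Finset.sum_le_sum fun y _ => ?_)
        refine (iidProb_forall_eq_le hw hsum ι hι _).trans_eq ?_
        rw [Fintype.prod_option, Fintype.prod_prod_type]
        simp [pow_two]
    _ = ∑ x, w x * (∑ s ∈ D x, w s ^ 2) ^ r := by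
        refine Finset.sum_congr rfl fun x _ => ?_
        rw [← Finset.mul_sum,
          ← Finset.prod_univ_sum (fun _ : Fin r => D x) (fun _ s => w s ^ 2)]
        simp
    _ ≤ ∑ x, w x * M ^ r := by
        refine Finset.sum_le_sum fun x _ => mul_le_mul_of_nonneg_left ?_ (hw x)
        exact pow_le_pow_left₀ (Finset.sum_nonneg fun s _ => sq_nonneg _) (hD x) r
    _ = M ^ r := by rw [← Finset.sum_mul, hsum, one_mul]

end IidProb

/-- The values following `x` whose distance to `x` has mass at most `d`. -/
noncomputable def massWindow {α : Type*} [Fintype α] (w : α → ℝ) (v : α → ℕ) (d : ℝ) (x : α) :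
    Finset α :=
  univ.filter fun y => v x < v y ∧ ∑ z with v x < v z ∧ v z < v y, w z ≤ d

section MassWindow

variable {α : Type*} [Fintype α] {w : α → ℝ} {v : α → ℕ} {d : ℝ} {x y z : α}

lemma lt_of_notMem_massWindow (hw : ∀ s, 0 ≤ w s) (hxy : v x < v y)
    (hy : y ∉ massWindow w v d x) (hz : z ∈ massWindow w v d x) : v z < v y := by
  by_contra! h
  simp only [massWindow, mem_filter, mem_univ, true_and] at hy hz
  refine hy ⟨hxy, le_trans ?_ hz.2⟩
  refine Finset.sum_le_sum_of_subset_of_nonneg ?_ fun s _ _ => hw s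
  exact Finset.monotone_filter_right _ fun s _ hs => ⟨hs.1, hs.2.trans_le h⟩

lemma le_sum_massWindow (hw : ∀ s, 0 ≤ w s) (hxy : v x < v y)
    (hy : y ∉ massWindow w v d x) : d ≤ ∑ s ∈ massWindow w v d x, w s := by
  classical
  obtain ⟨m, hm, hmin⟩ := Finset.exists_min_image
    (univ.filter fun y => v x < v y ∧ y ∉ massWindow w v d x) v ⟨y, by simp [hxy, hy]⟩
  simp only [mem_filter, mem_univ, true_and] at hm hmin
  have h1 : d < ∑ z with v x < v z ∧ v z < v m, w z := by
    by_contra! h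
    exact hm.2 (by simp [massWindow, hm.1, h])
  refine h1.le.trans (Finset.sum_le_sum_of_subset_of_nonneg ?_ fun s _ _ => hw s)
  intro s hs
  simp only [mem_filter, mem_univ, true_and] at hs
  by_contra h
  exact absurd (hmin s ⟨hs.1, h⟩) (by omega)

lemma sum_massWindow_le (hw : ∀ s, 0 ≤ w s) (hv : Function.Injective v) (hd : 0 ≤ d) {q : ℝ}
    (hq : ∀ s, w s ≤ q) (x : α) : ∑ s ∈ massWindow w v d x, w s ≤ d + q := by
  classical
  have hq0 : 0 ≤ q := (hw x).trans (hq x)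
  rcases (massWindow w v d x).eq_empty_or_nonempty with h | h
  · rw [h, Finset.sum_empty]; positivity
  obtain ⟨m, hm, hmax⟩ := Finset.exists_max_image _ v h
  have hm' := hm
  simp only [massWindow, mem_filter, mem_univ, true_and] at hm'
  calc _ ≤ ∑ s ∈ insert m (univ.filter fun z => v x < v z ∧ v z < v m), w s := by
        refine Finset.sum_le_sum_of_subset_of_nonneg ?_ fun s _ _ => hw s
        intro s hs
        have h1 := hmax s hs
        simp only [massWindow, mem_filter, mem_univ, true_and] at hs
        simp only [mem_insert, mem_filter, mem_univ, true_and]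
        rcases h1.eq_or_lt with h | h
        · exact Or.inl (hv h)
        · exact Or.inr ⟨hs.1, h⟩
    _ = w m + ∑ z with v x < v z ∧ v z < v m, w z := Finset.sum_insert (by simp)
    _ ≤ d + q := by linarith [hq m]

lemma sum_sq_insert_massWindow_le [DecidableEq α] (hw : ∀ s, 0 ≤ w s)
    (hv : Function.Injective v) (hd : 0 ≤ d) {q : ℝ} (hq : ∀ s, w s ≤ q) (x : α) :
    ∑ s ∈ insert x (massWindow w v d x), w s ^ 2 ≤ q * (d + 2 * q) := by
  have hx : x ∉ massWindow w v d x := by simp [massWindow]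
  calc _ ≤ ∑ s ∈ insert x (massWindow w v d x), q * w s := by
        refine Finset.sum_le_sum fun s _ => ?_
        rw [pow_two]
        exact mul_le_mul_of_nonneg_right (hq s) (hw s)
    _ = q * (w x + ∑ s ∈ massWindow w v d x, w s) := by
        rw [← Finset.mul_sum, Finset.sum_insert hx]
    _ ≤ q * (d + 2 * q) := by
        refine mul_le_mul_of_nonneg_left ?_ ((hw x).trans (hq x))
        linarith [hq x, sum_massWindow_le hw hv hd hq x]

end MassWindow

lemma lexVal_injective (k K : ℕ) : Function.Injective (lexVal : Str k K → ℕ) := by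
  intro s t h
  have key : ∀ s : Str k K, lexVal s = (finFunctionFinEquiv (fun j => s j.rev) : ℕ) := by
    intro s
    rw [finFunctionFinEquiv_apply, lexVal]
    refine Fintype.sum_equiv Fin.revPerm _ _ fun j => ?_
    have : K - 1 - (j : ℕ) = K - (j + 1) := by omega
    simp [Fin.val_rev, this]
  rw [key, key] at h
  have h2 := finFunctionFinEquiv.injective (Fin.ext h)
  funext j
  simpa using congrFun h2 j.rev

/-- A dense window of a sorted sequence either is long in mass with few samples, or contains many
disjoint pairs of equal strings close to its first string. -/
lemma exists_of_not_LSparse {k N K r : ℕ} (w : Str k K → ℝ) (hw : ∀ s, 0 ≤ w s) (d : ℝ)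
    (s : Fin N → Str k K) (hs : Monotone fun i => lexVal (s i))
    (h : ¬ LSparse (6 * r + 10) (edgeSet s)) :
    (∃ c, d ≤ ∑ z ∈ massWindow w lexVal d (s c), w z ∧
      (univ.filter fun i => s i ∈ massWindow w lexVal d (s c)).card < 6 * r + 10) ∨
    (∃ ι : Option (Fin r × Bool) → Fin N, Function.Injective ι ∧
      ∀ j, s (ι (some (j, false))) = s (ι (some (j, true))) ∧
        s (ι (some (j, false))) ∈ insert (s (ι none)) (massWindow w lexVal d (s (ι none)))) := by
  unfold LSparse at h
  push Not at h
  obtain ⟨i, hi⟩ := h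
  set D := (edgeSet s).filter
    (fun e => i ≤ (e.1 : ℕ) ∧ (e.2 : ℕ) ≤ i + (6 * r + 10) - 1) with hDdef
  have hDmem : ∀ e, e ∈ D ↔ ((e.2 : ℕ) = (e.1 : ℕ) + 1 ∧ s e.1 = s e.2) ∧
      (i ≤ (e.1 : ℕ) ∧ (e.2 : ℕ) ≤ i + (6 * r + 10) - 1) := by
    intro e; simp [hDdef, edgeSet]
  have hcard : 2 * r + 3 < D.card := by
    have h1 : 6 * r + 10 < 3 * D.card := by
      have : ((6 * r + 10 : ℕ) : ℝ) < 3 * D.card := by linarith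
      exact_mod_cast this
    omega
  obtain ⟨e₀, he₀⟩ : D.Nonempty := Finset.card_pos.mp (by omega)
  have he₀' := (hDmem e₀).1 he₀
  have hiN : i < N := lt_of_le_of_lt he₀'.2.1 e₀.1.2
  set c : Fin N := ⟨i, hiN⟩ with hc
  by_cases hall : ∀ e ∈ D, s e.1 ∈ insert (s c) (massWindow w lexVal d (s c))
  · right
    set D' := D.filter (fun e => (e.1 : ℕ) ≠ i) with hD'
    have hD'card : 2 * r ≤ D'.card := by
      have h1 : (D.filter (fun e => ¬ (e.1 : ℕ) ≠ i)).card ≤ 1 := by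
        rw [Finset.card_le_one]
        intro a ha b hb
        simp only [mem_filter, not_not, hDmem] at ha hb
        ext <;> omega
      have := Finset.card_filter_add_card_filter_not (s := D) (fun e => (e.1 : ℕ) ≠ i)
      rw [← hD'] at this
      omega
    obtain ⟨b, hb⟩ : ∃ b, r ≤ (D'.filter (fun e => (e.1 : ℕ) % 2 = b)).card := by
      by_contra! hlt
      have h0 := hlt 0
      have h1 := hlt 1
      have := Finset.card_filter_add_card_filter_not (s := D') (fun e => (e.1 : ℕ) % 2 = 0)
      have h2 : D'.filter (fun e => ¬ (e.1 : ℕ) % 2 = 0) = D'.filter (fun e => (e.1 : ℕ) % 2 = 1) :=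
        Finset.filter_congr fun e _ => by omega
      rw [h2] at this
      omega
    obtain ⟨T, hT, hTc⟩ := Finset.exists_subset_card_eq hb
    let f : Fin r ≃ T := (T.equivFinOfCardEq hTc).symm
    have hf : ∀ j, (((f j).1.2 : ℕ) = ((f j).1.1 : ℕ) + 1 ∧ s (f j).1.1 = s (f j).1.2) ∧
        i < ((f j).1.1 : ℕ) ∧ ((f j).1.1 : ℕ) % 2 = b ∧ (f j).1 ∈ D := by
      intro j
      have h1 := hT (f j).2
      simp only [hD', mem_filter] at h1
      have h2 := (hDmem _).1 h1.1.1
      exact ⟨h2.1, by omega, h1.2, h1.1.1⟩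
    refine ⟨fun o => o.elim c fun q => if q.2 then (f q.1).1.2 else (f q.1).1.1, ?_, ?_⟩
    · have hfin : ∀ j j', ((f j).1.1 : ℕ) = ((f j').1.1 : ℕ) → j = j' := by
        intro j j' hjj
        apply f.injective
        apply Subtype.ext
        have := hf j
        have := hf j'
        ext <;> omega
      rintro (_ | ⟨j, _ | _⟩) (_ | ⟨j', _ | _⟩) hEq <;>
        simp only [Option.elim, Bool.false_eq_true, if_true, if_false, Fin.ext_iff, hc] at hEq
      all_goals first
        | rfl
        | (have h1 := hf j; have h2 := hf j'
           first
            | omega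
            | (have := hfin j j' (by omega)
               rw [this]))
        | (have h1 := hf j; omega)
        | (have h1 := hf j'; omega)
    · intro j
      have := hf j
      simpa using ⟨this.1.2, by simpa using hall _ this.2.2.2⟩
  · left
    push Not at hall
    obtain ⟨e, he, hnot⟩ := hall
    rw [mem_insert, not_or] at hnot
    have he' := (hDmem e).1 he
    have hce : c ≤ e.1 := he'.2.1
    have hlt : lexVal (s c) < lexVal (s e.1) :=
      lt_of_le_of_ne (hs hce) fun hh => hnot.1 (lexVal_injective k K hh).symm
    refine ⟨c, le_sum_massWindow hw hlt hnot.2, ?_⟩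
    have hsub : (univ.filter fun j => s j ∈ massWindow w lexVal d (s c)) ⊆ Finset.Ioo c e.1 := by
      intro j hj
      simp only [mem_filter, mem_univ, true_and] at hj
      have h1 := lt_of_notMem_massWindow hw hlt hnot.2 hj
      have h2 : lexVal (s c) < lexVal (s j) := by
        simp only [massWindow, mem_filter] at hj
        exact hj.2.1
      rw [Finset.mem_Ioo]
      exact ⟨hs.reflect_lt h2, hs.reflect_lt h1⟩
    have := Finset.card_le_card hsub
    rw [Fin.card_Ioo] at this
    have hci : (c : ℕ) = i := rfl
    omega

lemma card_filter_sortedSeq {k N K : ℕ} (ω : Fin N → Str k K) (P : Str k K → Prop)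
    [DecidablePred P] :
    (univ.filter fun i => P (sortedSeq ω i)).card = (univ.filter fun i => P (ω i)).card :=
  Finset.card_equiv (Tuple.sort fun j => lexVal (ω j)) fun i =>
    Finset.mem_filter.trans (Iff.trans (by simp [sortedSeq]) Finset.mem_filter.symm)

lemma iidProb_not_LSparse_le {k N K : ℕ} {w : Str k K → ℝ} (hw : ∀ s, 0 ≤ w s)
    (hsum : ∑ s, w s = 1) {d q : ℝ} (hd : 0 ≤ d) (hq : ∀ s, w s ≤ q) (r : ℕ) :
    iidProb w (fun ω : Fin N → Str k K => ¬ LSparse (6 * r + 10) (edgeSet (sortedSeq ω))) ≤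
      N * (Real.exp (6 * r + 10 : ℕ) * Real.exp (-((N - 1) * (d / 2)))) +
        N ^ (2 * r + 1) * (q * (d + 2 * q)) ^ r := by
  classical
  set F : (Fin N → Str k K) → Prop := fun ω => ∃ c ∈ univ,
    ∃ x ∈ univ.filter (fun x => d ≤ ∑ z ∈ massWindow w lexVal d x, w z),
      ω c = x ∧ (univ.filter fun i => ω i ∈ massWindow w lexVal d x).card < 6 * r + 10 with hF
  set G : (Fin N → Str k K) → Prop := fun ω =>
    ∃ ι ∈ univ.filter (fun ι : Option (Fin r × Bool) → Fin N => Function.Injective ι),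
      ∀ j, ω (ι (some (j, false))) = ω (ι (some (j, true))) ∧
        ω (ι (some (j, false))) ∈ insert (ω (ι none)) (massWindow w lexVal d (ω (ι none))) with hG
  have hFG : ∀ ω : Fin N → Str k K, ¬ LSparse (6 * r + 10) (edgeSet (sortedSeq ω)) →
      F ω ∨ G ω := by
    intro ω h
    have hmono : Monotone fun i => lexVal (sortedSeq ω i) :=
      Tuple.monotone_sort fun j => lexVal (ω j)
    rcases exists_of_not_LSparse w hw d (sortedSeq ω) hmono h with ⟨c, h1, h2⟩ | ⟨ι, h1, h2⟩
    · rw [card_filter_sortedSeq ω (· ∈ massWindow w lexVal d (sortedSeq ω c))] at h2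
      exact Or.inl ⟨_, mem_univ _, sortedSeq ω c, by simpa using h1, rfl, h2⟩
    · exact Or.inr ⟨fun b => Tuple.sort (fun j => lexVal (ω j)) (ι b),
        Finset.mem_filter.mpr
        ⟨mem_univ _, (Tuple.sort fun j => lexVal (ω j)).injective.comp h1⟩, h2⟩
  refine (iidProb_mono hw hFG).trans ((iidProb_or_le hw F G).trans (add_le_add ?_ ?_))
  · refine (iidProb_exists_le hw _ _).trans ?_
    calc _ ≤ ∑ _c : Fin N, Real.exp (6 * r + 10 : ℕ) * Real.exp (-((N - 1) * (d / 2))) := by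
          refine Finset.sum_le_sum fun c _ => (iidProb_exists_le hw _ _).trans ?_
          calc _ ≤ ∑ x with d ≤ ∑ z ∈ massWindow w lexVal d x, w z,
                w x * (Real.exp (6 * r + 10 : ℕ) * Real.exp (-((N - 1) * (d / 2)))) := by
                refine Finset.sum_le_sum fun x hx => ?_
                exact iidProb_eq_and_card_lt_le hw hsum _ (Finset.mem_filter.mp hx).2 c x _
            _ ≤ ∑ x, w x * (Real.exp (6 * r + 10 : ℕ) * Real.exp (-((N - 1) * (d / 2)))) :=
                Finset.sum_le_sum_of_subset_of_nonneg (Finset.filter_subset _ _) fun x _ _ =>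
                  mul_nonneg (hw x) (by positivity)
            _ = _ := by rw [← Finset.sum_mul, hsum, one_mul]
      _ = _ := by simp
  · refine (iidProb_exists_le hw _ _).trans ?_
    calc _ ≤ ∑ ι : Option (Fin r × Bool) → Fin N with Function.Injective ι,
            (q * (d + 2 * q)) ^ r := by
          refine Finset.sum_le_sum fun ι hι => ?_
          exact iidProb_pairs_le hw hsum ι (Finset.mem_filter.mp hι).2
            (fun x => insert x (massWindow w lexVal d x))
            (sum_sq_insert_massWindow_le hw (lexVal_injective k K) hd hq)
      _ = ((univ.filter (fun ι : Option (Fin r × Bool) → Fin N => Function.Injective ι)).card : ℝ)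
            * (q * (d + 2 * q)) ^ r := by rw [Finset.sum_const, nsmul_eq_mul]
      _ ≤ N ^ (2 * r + 1) * (q * (d + 2 * q)) ^ r := by
          rcases isEmpty_or_nonempty (Str k K) with he | ⟨⟨s⟩⟩
          · simp at hsum
          have hq0 : 0 ≤ q := (hw s).trans (hq s)
          refine mul_le_mul_of_nonneg_right ?_ (by positivity)
          have := Finset.card_filter_le univ
            (fun ι : Option (Fin r × Bool) → Fin N => Function.Injective ι)
          rw [Finset.card_univ, Fintype.card_fun, Fintype.card_option, Fintype.card_prod,
            Fintype.card_bool, Fintype.card_fin, Fintype.card_fin, mul_comm r 2] at this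
          exact_mod_cast this

section StrP

variable {k : ℕ} {p : Fin k → ℝ}

lemma strP_nonneg (hp : ∀ i, 0 ≤ p i) {K : ℕ} (s : Str k K) : 0 ≤ strP p s :=
  Finset.prod_nonneg fun _ _ => hp _

lemma sum_strP (hsum : ∑ i, p i = 1) (K : ℕ) : ∑ s : Str k K, strP p s = 1 := by
  have := Finset.prod_univ_sum (fun _ : Fin K => (univ : Finset (Fin k))) (fun _ s => p s)
  rw [Fintype.piFinset_univ] at this
  simp only [strP]
  rw [← this]
  simp [hsum]

lemma strP_le_pmax_pow (hp : ∀ i, 0 ≤ p i) {K : ℕ} (s : Str k K) : strP p s ≤ pmax p ^ K := by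
  calc strP p s ≤ ∏ _j : Fin K, pmax p :=
        Finset.prod_le_prod (fun _ _ => hp _) fun j _ =>
          le_ciSup (Set.finite_range p).bddAbove (s j)
    _ = pmax p ^ K := by simp

lemma pmax_pos (hk : 2 ≤ k) (hpos : ∀ i, 0 < p i) : 0 < pmax p :=
  (hpos ⟨0, by omega⟩).trans_le (le_ciSup (Set.finite_range p).bddAbove _)

lemma pmax_lt_one (hk : 2 ≤ k) (hpos : ∀ i, 0 < p i) (hsum : ∑ i, p i = 1) : pmax p < 1 := by
  have : Nonempty (Fin k) := ⟨⟨0, by omega⟩⟩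
  obtain ⟨i, hi⟩ := exists_eq_ciSup_of_finite (f := p)
  have : Nontrivial (Fin k) := Fin.nontrivial_iff_two_le.mpr hk
  obtain ⟨j, hj⟩ := exists_ne i
  rw [pmax, ← hi, ← hsum]
  exact Finset.single_lt_sum (f := p) hj (mem_univ i) (mem_univ j) (hpos j)
    fun l _ _ => (hpos l).le

lemma sum_strP_beginsWith2_le (hp : ∀ i, 0 ≤ p i) (hsum : ∑ i, p i = 1) (d : Fin k) (K : ℕ) :
    ∑ s : Str k K with beginsWith2 d s, strP p s ≤ p d ^ 2 := by
  rcases lt_or_ge K 2 with hK | hK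
  · rw [Finset.filter_false_of_mem, Finset.sum_empty]
    · positivity
    · rintro s _ ⟨h, _⟩
      omega
  obtain ⟨n, rfl⟩ := Nat.exists_eq_add_of_le' hK
  set g : Fin (n + 2) → Fin k → ℝ := fun j a => if (j : ℕ) < 2 ∧ a ≠ d then 0 else p a with hg
  have hg0 : ∀ j a, 0 ≤ g j a := fun j a => by
    simp only [hg]
    split_ifs
    exacts [le_rfl, hp a]
  have h := Finset.prod_univ_sum (fun _ : Fin (n + 2) => (univ : Finset (Fin k))) g
  have hprod : ∏ j, ∑ a, g j a = p d ^ 2 := by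
    rw [Fin.prod_univ_succ, Fin.prod_univ_succ]
    simp [hg, hsum, pow_two, ite_not]
  rw [Fintype.piFinset_univ, hprod] at h
  rw [h, Finset.sum_filter]
  refine Finset.sum_le_sum fun s _ => ?_
  split_ifs with hs
  · obtain ⟨_, h0, h1⟩ := hs
    refine Finset.prod_le_prod (fun _ _ => hp _) fun j _ => le_of_eq ?_
    rw [hg]
    refine (if_neg ?_).symm
    rintro ⟨hj, hne⟩
    rcases (by omega : (j : ℕ) = 0 ∨ (j : ℕ) = 1) with hj | hj
    · exact hne (by rw [← h0]; congr 1; exact Fin.ext hj)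
    · exact hne (by rw [← h1]; congr 1; exact Fin.ext hj)
  · exact Finset.prod_nonneg fun j _ => hg0 _ _

end StrP

lemma exp_neg_mul_le_div {c : ℝ} (hc : 0 < c) {N : ℝ} (hN : 0 < N) :
    Real.exp (-(N * c)) ≤ c⁻¹ * N⁻¹ := by
  rw [Real.exp_neg, ← mul_inv, mul_comm c N]
  exact inv_anti₀ (by positivity) (by linarith [Real.add_one_le_exp (N * c)])

/-- A stretched exponential is `O(N⁻²)`. -/
lemma exists_exp_neg_rpow_le {η : ℝ} (hη : 0 < η) :
    ∃ C : ℝ, 0 ≤ C ∧ ∀ N : ℝ, 1 ≤ N → Real.exp (-(N ^ η / 2)) ≤ C * (N⁻¹) ^ 2 := by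
  obtain ⟨m, hm⟩ := exists_nat_gt (2 / η)
  have hm2 : 2 ≤ η * m := by
    rw [div_lt_iff₀ hη] at hm
    linarith
  refine ⟨2 ^ m * m.factorial, by positivity, fun N hN => ?_⟩
  have hN0 : 0 < N := by linarith
  have h1 := Real.pow_div_factorial_le_exp (N ^ η / 2) (by positivity) m
  have h2 : N ^ 2 ≤ (N ^ η) ^ m := by
    rw [← Real.rpow_natCast (N ^ η), ← Real.rpow_mul hN0.le, ← Real.rpow_natCast N 2]
    exact Real.rpow_le_rpow_of_exponent_le hN (by exact_mod_cast hm2)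
  rw [Real.exp_neg]
  calc (Real.exp (N ^ η / 2))⁻¹ ≤ (N ^ 2 / (2 ^ m * m.factorial))⁻¹ := by
        refine inv_anti₀ (by positivity) (le_trans ?_ h1)
        rw [div_pow, div_div]
        gcongr
    _ = _ := by field_simp

lemma pmax_pow_le {k : ℕ} {p : Fin k → ℝ} (h0 : 0 < pmax p) (h1 : pmax p < 1) {ε : ℝ} {N K : ℕ}
    (hN : 1 ≤ N) (hK : (Ctilde p + ε) * Real.log N ≤ K) :
    pmax p ^ K ≤ (N : ℝ) ^ (-(1 + ε * Real.log (1 / pmax p))) := by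
  have hN0 : (0 : ℝ) < N := by exact_mod_cast hN
  have hl : 0 < Real.log (1 / pmax p) := Real.log_pos (by rw [lt_div_iff₀ h0]; linarith)
  rw [← Real.rpow_natCast, Real.rpow_def_of_pos h0, Real.rpow_def_of_pos hN0]
  apply Real.exp_le_exp.mpr
  have h2 : Real.log (pmax p) = - Real.log (1 / pmax p) := by simp
  have h3 := mul_le_mul_of_nonneg_right hK hl.le
  have h4 : Ctilde p * Real.log (1 / pmax p) = 1 := by
    rw [Ctilde]; field_simp
  rw [h2]
  have h5 : (Ctilde p + ε) * Real.log N * Real.log (1 / pmax p) =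
    Real.log N * (Ctilde p * Real.log (1 / pmax p) + ε * Real.log (1 / pmax p)) := by ring
  rw [h5, h4] at h3
  linarith

open scoped Classical in
/-- **Lemma (L-sparsity)**: for every `p` and `ε > 0` there are `L ≥ 10`, `δ > 0` and a
constant `A` such that for all `N` and all `K ≥ (C̃_p + ε) log N`, a `p`-random sorted
sequence of `N` strings of length `K` is regular and has an `L`-sparse shuffle graph with
probability at least `1 - A N^{-δ}`. -/
theorem regular_and_LSparse_whp (k : ℕ) (hk : 2 ≤ k) (p : Fin k → ℝ)
    (hpos : ∀ i, 0 < p i) (hsum : ∑ i, p i = 1) (ε : ℝ) (hε : 0 < ε) :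
    ∃ L : ℕ, 10 ≤ L ∧ ∃ δ : ℝ, 0 < δ ∧ ∃ A : ℝ, ∀ N K : ℕ,
      (Ctilde p + ε) * Real.log N ≤ (K : ℝ) →
      1 - A * (N : ℝ) ^ (-δ) ≤
        ∑ ω ∈ univ.filter (fun ω : Fin N → Str k K =>
            Regular p ⟨0, by omega⟩ ⟨k - 1, by omega⟩ (sortedSeq ω) ∧
              LSparse L (edgeSet (sortedSeq ω))),
          seqP p ω := by
  have hp : ∀ i, 0 ≤ p i := fun i => (hpos i).le
  have hm0 := pmax_pos hk hpos
  have hm1 := pmax_lt_one hk hpos hsum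
  set e := ε * Real.log (1 / pmax p) with he
  have he0 : 0 < e := mul_pos hε (Real.log_pos (by rw [lt_div_iff₀ hm0]; linarith))
  set η := min e 1 / 2 with hη
  have hη0 : 0 < η := by positivity
  have hη1 : η ≤ 1 := by have := min_le_right e 1; linarith
  have hηe : η ≤ e / 2 := by have := min_le_left e 1; linarith
  obtain ⟨C, hC0, hC⟩ := exists_exp_neg_rpow_le hη0
  obtain ⟨r, hr⟩ := exists_nat_gt (4 / e)
  have hr2 : 2 ≤ e / 2 * r := by
    rw [div_lt_iff₀ he0] at hr
    linarith
  have hple : ∀ i, p i ≤ 1 := fun i => by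
    rw [← hsum]; exact Finset.single_le_sum (fun j _ => hp j) (mem_univ i)
  set i0 : Fin k := ⟨0, by omega⟩
  set i1 : Fin k := ⟨k - 1, by omega⟩
  set c := p i0 * p i1 / 2 with hc
  have hc0 : 0 < c := by have := hpos i0; have := hpos i1; positivity
  have hc1 : c ≤ 1 := by
    have := mul_le_one₀ (hple i0) (hp i1) (hple i1)
    linarith
  refine ⟨6 * r + 10, by omega, 1, one_pos,
    2 * (c ^ 2 / 4)⁻¹ + (Real.exp (6 * r + 10 : ℕ) * Real.exp (1 / 2) * C + 3 ^ r), ?_⟩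
  intro N K hNK
  have hw : ∀ s : Str k K, 0 ≤ strP p s := strP_nonneg hp
  have hws := sum_strP hsum K
  set E : (Fin N → Str k K) → Prop := fun ω => Regular p i0 i1 (sortedSeq ω) ∧
    LSparse (6 * r + 10) (edgeSet (sortedSeq ω)) with hE
  refine le_of_le_of_eq (b := iidProb (strP p) E) ?_ (by unfold iidProb seqP; congr)
  have htot := iidProb_add_not (N := N) hws E
  rcases Nat.eq_zero_or_pos N with rfl | hN
  · have hall : ∀ ω, E ω := by
      refine fun ω => ⟨by simp [Regular], fun i => ?_⟩
      rw [Finset.eq_empty_of_isEmpty (Finset.filter _ _), Finset.card_empty, Nat.cast_zero]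
      positivity
    have hzero : iidProb (strP p) (fun ω => ¬ E ω) = 0 := by simp [iidProb, hall]
    rw [Nat.cast_zero, Real.zero_rpow (by norm_num), mul_zero]
    linarith
  have hN1 : (1 : ℝ) ≤ N := by exact_mod_cast hN
  have hN0 : (0 : ℝ) < N := by linarith
  rw [Real.rpow_neg_one]
  suffices h : iidProb (strP p) (fun ω => ¬ E ω) ≤ (2 * (c ^ 2 / 4)⁻¹ +
      (Real.exp (6 * r + 10 : ℕ) * Real.exp (1 / 2) * C + 3 ^ r)) * (N : ℝ)⁻¹ by linarith
  set R : Fin k → (Fin N → Str k K) → Prop := fun i ω =>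
    (p i ^ 2 + c) * N < ((univ.filter fun j => beginsWith2 i (ω j)).card : ℝ) with hR
  have hRle : ∀ i, iidProb (strP p) (R i) ≤ (c ^ 2 / 4)⁻¹ * (N : ℝ)⁻¹ := fun i =>
    (iidProb_card_gt_le hw hws (beginsWith2 i) (sum_strP_beginsWith2_le hp hsum i K)
      (pow_le_one₀ (hp i) (hple i)) hc0.le hc1).trans (exp_neg_mul_le_div (by positivity) hN0)
  have hsplit : ∀ ω, ¬ E ω →
      (R i0 ω ∨ R i1 ω) ∨ ¬ LSparse (6 * r + 10) (edgeSet (sortedSeq ω)) := by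
    intro ω h
    by_contra! hcon
    simp only [hR, not_lt] at hcon
    refine h ⟨⟨?_, ?_⟩, hcon.2⟩
    · rw [card_filter_sortedSeq ω (beginsWith2 i0)]
      exact hcon.1.1
    · rw [card_filter_sortedSeq ω (beginsWith2 i1)]
      exact hcon.1.2
  have hbad := iidProb_not_LSparse_le (N := N) hw hws (d := (N : ℝ) ^ (η - 1))
    (q := (N : ℝ) ^ (-(1 + e))) (by positivity)
    (fun s => (strP_le_pmax_pow hp s).trans (pmax_pow_le hm0 hm1 hN hNK)) r
  have hfew : (N : ℝ) * (Real.exp (6 * r + 10 : ℕ) *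
      Real.exp (-((N - 1) * ((N : ℝ) ^ (η - 1) / 2)))) ≤
      Real.exp (6 * r + 10 : ℕ) * Real.exp (1 / 2) * C * (N : ℝ)⁻¹ := by
    have hd1 : (N : ℝ) ^ (η - 1) ≤ 1 := Real.rpow_le_one_of_one_le_of_nonpos hN1 (by linarith)
    have hdN : (N : ℝ) * (N : ℝ) ^ (η - 1) = (N : ℝ) ^ η := by
      rw [Real.rpow_sub_one hN0.ne']; field_simp
    have h1 : Real.exp (-((N - 1) * ((N : ℝ) ^ (η - 1) / 2))) ≤
        Real.exp (1 / 2) * (C * ((N : ℝ)⁻¹) ^ 2) := by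
      refine le_trans ?_ (mul_le_mul_of_nonneg_left (hC N hN1) (Real.exp_pos _).le)
      rw [← Real.exp_add]
      apply Real.exp_le_exp.mpr
      linarith
    calc _ ≤ (N : ℝ) * (Real.exp (6 * r + 10 : ℕ) *
          (Real.exp (1 / 2) * (C * ((N : ℝ)⁻¹) ^ 2))) := by gcongr
      _ = _ := by field_simp
  have hpairs : (N : ℝ) ^ (2 * r + 1) * ((N : ℝ) ^ (-(1 + e)) *
      ((N : ℝ) ^ (η - 1) + 2 * (N : ℝ) ^ (-(1 + e)))) ^ r ≤ 3 ^ r * (N : ℝ)⁻¹ := by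
    have hqd : (N : ℝ) ^ (-(1 + e)) ≤ (N : ℝ) ^ (η - 1) :=
      Real.rpow_le_rpow_of_exponent_le hN1 (by linarith)
    have hprod : (N : ℝ) ^ 2 * ((N : ℝ) ^ (-(1 + e)) * (N : ℝ) ^ (η - 1)) ≤
        (N : ℝ) ^ (-(e / 2)) := by
      rw [← Real.rpow_natCast, ← Real.rpow_add hN0, ← Real.rpow_add hN0]
      refine Real.rpow_le_rpow_of_exponent_le hN1 ?_
      push_cast
      linarith
    have hfin : ((N : ℝ) ^ (-(e / 2))) ^ r ≤ ((N : ℝ)⁻¹) ^ 2 := by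
      rw [← Real.rpow_natCast, ← Real.rpow_mul hN0.le, ← Real.rpow_neg_one,
        ← Real.rpow_natCast, ← Real.rpow_mul hN0.le]
      refine Real.rpow_le_rpow_of_exponent_le hN1 ?_
      push_cast
      linarith
    calc _ ≤ (N : ℝ) ^ (2 * r + 1) * ((N : ℝ) ^ (-(1 + e)) * (3 * (N : ℝ) ^ (η - 1))) ^ r := by
          gcongr
          linarith
      _ = 3 ^ r * N * ((N : ℝ) ^ 2 * ((N : ℝ) ^ (-(1 + e)) * (N : ℝ) ^ (η - 1))) ^ r := by
          simp only [mul_pow]; ring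
      _ ≤ 3 ^ r * N * ((N : ℝ) ^ (-(e / 2))) ^ r := by gcongr
      _ ≤ 3 ^ r * N * ((N : ℝ)⁻¹) ^ 2 := by gcongr
      _ = _ := by field_simp
  have h1 := iidProb_mono hw hsplit
  have h2 := iidProb_or_le hw (fun ω => R i0 ω ∨ R i1 ω)
    (fun ω => ¬ LSparse (6 * r + 10) (edgeSet (sortedSeq ω)))
  have h3 := iidProb_or_le hw (R i0) (R i1)
  linarith [hRle i0, hRle i1]

end RiffleShuffle
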